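/- Let M, a be reals with 0 < a < M, and let A ≠ 0, B, α, β, u₀ be real constants with α² + β² > 0. Define g̃(φ) = α cos(Aφ) − β sin(Aφ), f₁(t,φ) = −g̃ cos(Bt/a) − (g̃′/A) sin(Bt/a), f₂(t,φ) = (g̃′/A) cos(Bt/a) − g̃ sin(Bt/a) with g̃′ = dg̃/dφ, and u = u₀ e^{B cosθ} / (sinθ √Δ (tan(θ/2))^A), using cscθ − cotθ = tan(θ/2) > 0 on (0,π). Then on U the 2-form F₈ = (u₀ e^{B cosθ} / (√(α²+β²) sinθ (tan(θ/2))^A)) [ f₁ dθ ∧ (dt − a sin²θ dφ) − f₂ sinθ dt ∧ dφ ] is closed and force-free (F₈_{μν} j^ν = 0 for its current density j), and F₈² := g^{μα}g^{νβ}F₈_{αβ}F₈_{μν} = −2u², so F₈ is electrically dominated. -/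

import Mathlib

noncomputable section

/-- Partial derivative of `f` in the coordinate direction `μ`,
coordinates `(x 0, x 1, x 2, x 3) = (t, r, θ, φ)`. -/
def pd (μ : Fin 4) (f : (Fin 4 → ℝ) → ℝ) (x : Fin 4 → ℝ) : ℝ :=
  fderiv ℝ f x (Pi.single μ 1)

/-- ρ² = r² + a² cos²θ. -/
def rho2 (a : ℝ) (x : Fin 4 → ℝ) : ℝ := (x 1) ^ 2 + a ^ 2 * Real.cos (x 2) ^ 2

/-- Δ = r² − 2Mr + a². -/
def Del (M a : ℝ) (x : Fin 4 → ℝ) : ℝ := (x 1) ^ 2 - 2 * M * (x 1) + a ^ 2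

/-- Σ² = (r²+a²)² − Δ a² sin²θ. -/
def Sig2 (M a : ℝ) (x : Fin 4 → ℝ) : ℝ :=
  ((x 1) ^ 2 + a ^ 2) ^ 2 - Del M a x * a ^ 2 * Real.sin (x 2) ^ 2

/-- The Kerr metric in Boyer–Lindquist coordinates `(t, r, θ, φ)`. -/
def kerr (M a : ℝ) (x : Fin 4 → ℝ) : Matrix (Fin 4) (Fin 4) ℝ :=
  Matrix.of fun μ ν =>
    if μ = 0 ∧ ν = 0 then -1 + 2 * M * (x 1) / rho2 a x
    else if (μ = 0 ∧ ν = 3) ∨ (μ = 3 ∧ ν = 0) then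
      -(2 * M * (x 1) * a * Real.sin (x 2) ^ 2) / rho2 a x
    else if μ = 1 ∧ ν = 1 then rho2 a x / Del M a x
    else if μ = 2 ∧ ν = 2 then rho2 a x
    else if μ = 3 ∧ ν = 3 then Sig2 M a x * Real.sin (x 2) ^ 2 / rho2 a x
    else 0

/-- The exterior Kerr domain U = {r > r₊, 0 < θ < π}. -/
def KerrExt (M a : ℝ) : Set (Fin 4 → ℝ) :=
  {x | M + Real.sqrt (M ^ 2 - a ^ 2) < x 1 ∧ 0 < x 2 ∧ x 2 < Real.pi}

/-- `wedge μ ν f` is the antisymmetric matrix of the 2-form `f dx^μ ∧ dx^ν`. -/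
def wedge (μ ν : Fin 4) (f : ℝ) : Matrix (Fin 4) (Fin 4) ℝ :=
  Matrix.of fun i j => if i = μ ∧ j = ν then f else if i = ν ∧ j = μ then -f else 0

/-- A 2-form `F` is closed on `S`: ∂_μ F_{νλ} + ∂_ν F_{λμ} + ∂_λ F_{μν} = 0. -/
def Closed2Form (F : (Fin 4 → ℝ) → Matrix (Fin 4) (Fin 4) ℝ) (S : Set (Fin 4 → ℝ)) : Prop :=
  ∀ x ∈ S, ∀ μ ν lam : Fin 4,
    pd μ (fun y => F y ν lam) x + pd ν (fun y => F y lam μ) x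
      + pd lam (fun y => F y μ ν) x = 0

/-- Current density j^μ = (ρ²sinθ)⁻¹ ∂_ν (ρ²sinθ g^{μα} g^{νβ} F_{αβ}). -/
def current (M a : ℝ) (F : (Fin 4 → ℝ) → Matrix (Fin 4) (Fin 4) ℝ)
    (x : Fin 4 → ℝ) (μ : Fin 4) : ℝ :=
  (rho2 a x * Real.sin (x 2))⁻¹ *
    ∑ ν : Fin 4, pd ν (fun y => rho2 a y * Real.sin (y 2) *
      ∑ i : Fin 4, ∑ j : Fin 4, (kerr M a y)⁻¹ μ i * (kerr M a y)⁻¹ ν j * F y i j) x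

/-- `F` is force-free on `S`: F_{μν} j^ν = 0 for the current density `j` of `F`. -/
def ForceFree (M a : ℝ) (F : (Fin 4 → ℝ) → Matrix (Fin 4) (Fin 4) ℝ)
    (S : Set (Fin 4 → ℝ)) : Prop :=
  ∀ x ∈ S, ∀ μ : Fin 4, ∑ ν : Fin 4, F x μ ν * current M a F x ν = 0

/-- The invariant F² = g^{μα} g^{νβ} F_{αβ} F_{μν}. -/
def Fsq (M a : ℝ) (F : (Fin 4 → ℝ) → Matrix (Fin 4) (Fin 4) ℝ) (x : Fin 4 → ℝ) : ℝ :=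
  ∑ μ : Fin 4, ∑ ν : Fin 4, ∑ i : Fin 4, ∑ j : Fin 4,
    (kerr M a x)⁻¹ μ i * (kerr M a x)⁻¹ ν j * F x i j * F x μ ν

/-- g̃(φ) = α cos(Aφ) − β sin(Aφ). -/
def gt12 (A α β : ℝ) : ℝ → ℝ := fun φ => α * Real.cos (A * φ) - β * Real.sin (A * φ)

/-- f₁ = −g̃ cos(Bt/a) − (g̃′/A) sin(Bt/a). -/
def f1_12 (a A B α β : ℝ) (t φ : ℝ) : ℝ :=
  -gt12 A α β φ * Real.cos (B * t / a) - (deriv (gt12 A α β) φ / A) * Real.sin (B * t / a)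

/-- f₂ = (g̃′/A) cos(Bt/a) − g̃ sin(Bt/a). -/
def f2_12 (a A B α β : ℝ) (t φ : ℝ) : ℝ :=
  (deriv (gt12 A α β) φ / A) * Real.cos (B * t / a) - gt12 A α β φ * Real.sin (B * t / a)

/-- u = u₀ e^{B cosθ} / (sinθ √Δ (tan(θ/2))^A), using cscθ − cotθ = tan(θ/2). -/
def u12 (M a u₀ A B : ℝ) (x : Fin 4 → ℝ) : ℝ :=
  u₀ * Real.exp (B * Real.cos (x 2)) /
    (Real.sin (x 2) * Real.sqrt (Del M a x) * Real.tan (x 2 / 2) ^ (A : ℝ))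

/-- F₈ = (u₀ e^{B cosθ}/(√(α²+β²) sinθ (tan(θ/2))^A))
[ f₁ dθ ∧ (dt − a sin²θ dφ) − f₂ sinθ dt ∧ dφ ]. -/
def F8 (a A B α β u₀ : ℝ) (x : Fin 4 → ℝ) : Matrix (Fin 4) (Fin 4) ℝ :=
  wedge 2 0 (u₀ * Real.exp (B * Real.cos (x 2)) /
      (Real.sqrt (α ^ 2 + β ^ 2) * Real.sin (x 2) * Real.tan (x 2 / 2) ^ (A : ℝ)) *
      f1_12 a A B α β (x 0) (x 3))
    + wedge 2 3 (u₀ * Real.exp (B * Real.cos (x 2)) /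
      (Real.sqrt (α ^ 2 + β ^ 2) * Real.sin (x 2) * Real.tan (x 2 / 2) ^ (A : ℝ)) *
      f1_12 a A B α β (x 0) (x 3) * (-(a * Real.sin (x 2) ^ 2)))
    + wedge 0 3 (u₀ * Real.exp (B * Real.cos (x 2)) /
      (Real.sqrt (α ^ 2 + β ^ 2) * Real.sin (x 2) * Real.tan (x 2 / 2) ^ (A : ℝ)) *
      (-(f2_12 a A B α β (x 0) (x 3) * Real.sin (x 2))))


/-- The radial-free amplitude of `F8`. -/
def K8 (A B α β u₀ θ : ℝ) : ℝ :=
  u₀ * Real.exp (B * Real.cos θ) /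
      (Real.sqrt (α ^ 2 + β ^ 2) * Real.sin θ * Real.tan (θ / 2) ^ (A : ℝ))

lemma pd_of_update {f : (Fin 4 → ℝ) → ℝ} {x : Fin 4 → ℝ} {μ : Fin 4} {d : ℝ}
    (hf : DifferentiableAt ℝ f x)
    (hd : HasDerivAt (fun s => f (Function.update x μ s)) d (x μ)) : pd μ f x = d := by
  have h1 : HasDerivAt (Function.update x μ) (Pi.single μ (1 : ℝ)) (x μ) := hasDerivAt_update x μ (x μ)
  have h2 : HasFDerivAt f (fderiv ℝ f x) (Function.update x μ (x μ)) := by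
    simpa using hf.hasFDerivAt
  have h3 := h2.comp_hasDerivAt (x μ) h1
  exact h3.unique hd

lemma gt12_deriv (A α β φ : ℝ) :
    deriv (gt12 A α β) φ = -A * (α * Real.sin (A * φ) + β * Real.cos (A * φ)) := by
  have h : HasDerivAt (fun φ : ℝ => A * φ) A φ := by simpa using (hasDerivAt_id φ).const_mul A
  have := ((h.cos.const_mul α).sub (h.sin.const_mul β)).deriv
  unfold gt12
  refine Eq.trans this ?_
  ring

lemma f1_eq {a A B α β : ℝ} (hA : A ≠ 0) (t φ : ℝ) : f1_12 a A B α β t φ =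
    -(α * Real.cos (A * φ) - β * Real.sin (A * φ)) * Real.cos (B * t / a)
      + (α * Real.sin (A * φ) + β * Real.cos (A * φ)) * Real.sin (B * t / a) := by
  unfold f1_12
  rw [gt12_deriv, gt12]
  field_simp
  ring

lemma f2_eq {a A B α β : ℝ} (hA : A ≠ 0) (t φ : ℝ) : f2_12 a A B α β t φ =
    -(α * Real.sin (A * φ) + β * Real.cos (A * φ)) * Real.cos (B * t / a)
      - (α * Real.cos (A * φ) - β * Real.sin (A * φ)) * Real.sin (B * t / a) := by
  unfold f2_12
  rw [gt12_deriv, gt12]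
  field_simp

lemma f_sq {a A B α β : ℝ} (hA : A ≠ 0) (t φ : ℝ) :
    f1_12 a A B α β t φ ^ 2 + f2_12 a A B α β t φ ^ 2 = α ^ 2 + β ^ 2 := by
  rw [f1_eq hA, f2_eq hA]
  have h1 := Real.sin_sq_add_cos_sq (A * φ)
  have h2 := Real.sin_sq_add_cos_sq (B * t / a)
  generalize Real.sin (A * φ) = s at *
  generalize Real.cos (A * φ) = c at *
  generalize Real.sin (B * t / a) = S at *
  generalize Real.cos (B * t / a) = C at *
  linear_combination (α ^ 2 + β ^ 2) * h1 + (α ^ 2 + β ^ 2) * (s ^ 2 + c ^ 2) * h2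

lemma aux_lin (b y : ℝ) : HasDerivAt (fun s : ℝ => b * s) b y := by
  simpa using (hasDerivAt_id y).const_mul b

lemma aux_lin_div (B a y : ℝ) : HasDerivAt (fun s : ℝ => B * s / a) (B / a) y :=
  (aux_lin B y).div_const a

lemma f1_dt {a A B α β : ℝ} (hA : A ≠ 0) (t φ : ℝ) :
    HasDerivAt (fun t => f1_12 a A B α β t φ) (-(B / a) * f2_12 a A B α β t φ) t := by
  have h : (fun t => f1_12 a A B α β t φ) = _ := funext fun t => f1_eq hA t φ
  rw [h, f2_eq hA]
  have l := aux_lin_div B a t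
  refine ((l.cos.const_mul _).add (l.sin.const_mul _)).congr_deriv ?_
  ring

lemma f2_dt {a A B α β : ℝ} (hA : A ≠ 0) (t φ : ℝ) :
    HasDerivAt (fun t => f2_12 a A B α β t φ) ((B / a) * f1_12 a A B α β t φ) t := by
  have h : (fun t => f2_12 a A B α β t φ) = _ := funext fun t => f2_eq hA t φ
  rw [h, f1_eq hA]
  have l := aux_lin_div B a t
  refine ((l.cos.const_mul _).sub (l.sin.const_mul _)).congr_deriv ?_
  ring

lemma f1_dp {a A B α β : ℝ} (hA : A ≠ 0) (t φ : ℝ) :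
    HasDerivAt (fun φ => f1_12 a A B α β t φ) (-A * f2_12 a A B α β t φ) φ := by
  have h : (fun φ => f1_12 a A B α β t φ) = _ := funext fun φ => f1_eq hA t φ
  rw [h, f2_eq hA]
  have l := aux_lin A φ
  refine ((((l.cos.const_mul α).sub (l.sin.const_mul β)).neg.mul_const _).add
    (((l.sin.const_mul α).add (l.cos.const_mul β)).mul_const _)).congr_deriv ?_
  ring

lemma f2_dp {a A B α β : ℝ} (hA : A ≠ 0) (t φ : ℝ) :
    HasDerivAt (fun φ => f2_12 a A B α β t φ) (A * f1_12 a A B α β t φ) φ := by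
  have h : (fun φ => f2_12 a A B α β t φ) = _ := funext fun φ => f2_eq hA t φ
  rw [h, f1_eq hA]
  have l := aux_lin A φ
  refine ((((l.sin.const_mul α).add (l.cos.const_mul β)).neg.mul_const _).sub
    (((l.cos.const_mul α).sub (l.sin.const_mul β)).mul_const _)).congr_deriv ?_
  ring

lemma f1_diff {a A B α β : ℝ} (hA : A ≠ 0) (x : Fin 4 → ℝ) :
    DifferentiableAt ℝ (fun y : Fin 4 → ℝ => f1_12 a A B α β (y 0) (y 3)) x := by
  have h : (fun y : Fin 4 → ℝ => f1_12 a A B α β (y 0) (y 3)) = _ :=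
    funext fun y => f1_eq hA (y 0) (y 3)
  rw [h]
  simp only [div_eq_mul_inv]
  fun_prop

lemma f2_diff {a A B α β : ℝ} (hA : A ≠ 0) (x : Fin 4 → ℝ) :
    DifferentiableAt ℝ (fun y : Fin 4 → ℝ => f2_12 a A B α β (y 0) (y 3)) x := by
  have h : (fun y : Fin 4 → ℝ => f2_12 a A B α β (y 0) (y 3)) = _ :=
    funext fun y => f2_eq hA (y 0) (y 3)
  rw [h]
  simp only [div_eq_mul_inv]
  fun_prop

lemma tan_half_pos {θ : ℝ} (h0 : 0 < θ) (h1 : θ < Real.pi) : 0 < Real.tan (θ / 2) :=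
  Real.tan_pos_of_pos_of_lt_pi_div_two (by linarith) (by linarith)

lemma K8_deriv {A B α β u₀ θ : ℝ} (hab : 0 < α ^ 2 + β ^ 2) (h0 : 0 < θ) (h1 : θ < Real.pi) :
    HasDerivAt (K8 A B α β u₀) (K8 A B α β u₀ θ *
      (-B * Real.sin θ - Real.cos θ / Real.sin θ - A / Real.sin θ)) θ := by
  have hs : 0 < Real.sin θ := Real.sin_pos_of_pos_of_lt_pi h0 h1
  have ht := tan_half_pos h0 h1
  have hc : 0 < Real.cos (θ / 2) := Real.cos_pos_of_mem_Ioo ⟨by linarith, by linarith⟩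
  have hsq : 0 < Real.sqrt (α ^ 2 + β ^ 2) := Real.sqrt_pos.2 hab
  have hT : 0 < Real.tan (θ / 2) ^ A := Real.rpow_pos_of_pos ht A
  have hhalf : HasDerivAt (fun s : ℝ => s / 2) (1 / 2) θ := (hasDerivAt_id θ).div_const 2
  have htan : HasDerivAt (fun s : ℝ => Real.tan (s / 2)) (1 / Real.cos (θ / 2) ^ 2 * (1 / 2)) θ :=
    HasDerivAt.comp (h₂ := Real.tan) (h := fun s : ℝ => s / 2) θ (Real.hasDerivAt_tan hc.ne') hhalf
  have hpow := htan.rpow_const (p := A) (Or.inl ht.ne')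
  have hkey : 1 / Real.cos (θ / 2) ^ 2 * (1 / 2) * A * Real.tan (θ / 2) ^ (A - 1)
      = A / Real.sin θ * Real.tan (θ / 2) ^ A := by
    rw [Real.rpow_sub_one ht.ne']
    have e : Real.sin θ = 2 * Real.sin (θ / 2) * Real.cos (θ / 2) := by
      rw [← Real.sin_two_mul]; congr 1; ring
    have hs2 : 0 < Real.sin (θ / 2) := Real.sin_pos_of_pos_of_lt_pi (by linarith) (by linarith)
    rw [e]
    generalize Real.tan (θ / 2) ^ A = T
    rw [Real.tan_eq_sin_div_cos]
    field_simp
  rw [hkey] at hpow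
  have hnum := ((Real.hasDerivAt_cos θ).const_mul B).exp.const_mul u₀
  have hden := ((Real.hasDerivAt_sin θ).const_mul (Real.sqrt (α ^ 2 + β ^ 2))).mul hpow
  have hne : Real.sqrt (α ^ 2 + β ^ 2) * Real.sin θ * Real.tan (θ / 2) ^ A ≠ 0 := by positivity
  refine (hnum.div hden hne).congr_deriv ?_
  simp only [K8, Pi.mul_apply]
  field_simp
  ring

/-- `sin θ` times the amplitude. -/
def G8 (A B α β u₀ θ : ℝ) : ℝ := Real.sin θ * K8 A B α β u₀ θ

lemma G8_deriv {A B α β u₀ θ : ℝ} (hab : 0 < α ^ 2 + β ^ 2) (h0 : 0 < θ) (h1 : θ < Real.pi) :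
    HasDerivAt (G8 A B α β u₀) (K8 A B α β u₀ θ * (-B * Real.sin θ ^ 2 - A)) θ := by
  have hs : 0 < Real.sin θ := Real.sin_pos_of_pos_of_lt_pi h0 h1
  refine ((Real.hasDerivAt_sin θ).mul (K8_deriv hab h0 h1)).congr_deriv ?_
  field_simp
  ring

lemma K8_diff {A B α β u₀ : ℝ} (hab : 0 < α ^ 2 + β ^ 2) {x : Fin 4 → ℝ}
    (h0 : 0 < x 2) (h1 : x 2 < Real.pi) :
    DifferentiableAt ℝ (fun y : Fin 4 → ℝ => K8 A B α β u₀ (y 2)) x :=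
  DifferentiableAt.comp (g := K8 A B α β u₀) (f := fun y : Fin 4 → ℝ => y 2) x (K8_deriv hab h0 h1).differentiableAt (differentiableAt_apply 2 x)

lemma G8_diff {A B α β u₀ : ℝ} (hab : 0 < α ^ 2 + β ^ 2) {x : Fin 4 → ℝ}
    (h0 : 0 < x 2) (h1 : x 2 < Real.pi) :
    DifferentiableAt ℝ (fun y : Fin 4 → ℝ => G8 A B α β u₀ (y 2)) x :=
  DifferentiableAt.comp (g := G8 A B α β u₀) (f := fun y : Fin 4 → ℝ => y 2) x (G8_deriv hab h0 h1).differentiableAt (differentiableAt_apply 2 x)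

lemma Del_pos {M a : ℝ} (ha : 0 < a) (haM : a < M) {x : Fin 4 → ℝ} (hx : x ∈ KerrExt M a) :
    0 < Del M a x := by
  have h := hx.1
  have h2 : 0 ≤ M ^ 2 - a ^ 2 := by nlinarith
  have h3 := Real.sq_sqrt h2
  have h4 := Real.sqrt_nonneg (M ^ 2 - a ^ 2)
  unfold Del
  nlinarith

lemma r_pos {M a : ℝ} (ha : 0 < a) (haM : a < M) {x : Fin 4 → ℝ} (hx : x ∈ KerrExt M a) :
    0 < x 1 := by
  have h := hx.1
  have h4 := Real.sqrt_nonneg (M ^ 2 - a ^ 2)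
  linarith

lemma rho2_pos {M a : ℝ} (ha : 0 < a) (haM : a < M) {x : Fin 4 → ℝ} (hx : x ∈ KerrExt M a) :
    0 < rho2 a x := by
  have h := r_pos ha haM hx
  unfold rho2
  positivity

lemma isOpen_ext (M a : ℝ) : IsOpen (KerrExt M a) := by
  unfold KerrExt
  exact (isOpen_lt continuous_const (continuous_apply 1)).inter
    ((isOpen_lt continuous_const (continuous_apply 2)).inter
      (isOpen_lt (continuous_apply 2) continuous_const))

lemma kerr_inv {M a : ℝ} (ha : 0 < a) (haM : a < M) {x : Fin 4 → ℝ} (hx : x ∈ KerrExt M a) :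
    (kerr M a x)⁻¹ = !![-Sig2 M a x / (rho2 a x * Del M a x), 0, 0,
        -(2 * M * x 1 * a) / (rho2 a x * Del M a x);
      0, Del M a x / rho2 a x, 0, 0;
      0, 0, 1 / rho2 a x, 0;
      -(2 * M * x 1 * a) / (rho2 a x * Del M a x), 0, 0,
        (Del M a x - a ^ 2 * Real.sin (x 2) ^ 2) /
          (rho2 a x * Del M a x * Real.sin (x 2) ^ 2)] := by
  have hD := (Del_pos ha haM hx).ne'
  have hR := (rho2_pos ha haM hx).ne'
  have hs : Real.sin (x 2) ≠ 0 := (Real.sin_pos_of_pos_of_lt_pi hx.2.1 hx.2.2).ne'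
  have hc := Real.cos_sq' (x 2)
  apply Matrix.inv_eq_right_inv
  ext i j
  fin_cases i <;> fin_cases j <;>
    simp [Matrix.mul_apply, Fin.sum_univ_four, kerr] <;> field_simp <;>
    (try simp only [Sig2, rho2, Del, hc]) <;> ring

/-- The matrix of `F8` in terms of the amplitude. -/
lemma F8_eq (a A B α β u₀ : ℝ) (x : Fin 4 → ℝ) : F8 a A B α β u₀ x =
    !![0, 0, -(K8 A B α β u₀ (x 2) * f1_12 a A B α β (x 0) (x 3)),
        -(G8 A B α β u₀ (x 2) * f2_12 a A B α β (x 0) (x 3));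
      0, 0, 0, 0;
      K8 A B α β u₀ (x 2) * f1_12 a A B α β (x 0) (x 3), 0, 0,
        -(a * Real.sin (x 2) * (G8 A B α β u₀ (x 2) * f1_12 a A B α β (x 0) (x 3)));
      G8 A B α β u₀ (x 2) * f2_12 a A B α β (x 0) (x 3), 0,
        a * Real.sin (x 2) * (G8 A B α β u₀ (x 2) * f1_12 a A B α β (x 0) (x 3)), 0] := by
  unfold F8 G8
  rw [← K8]
  ext i j
  fin_cases i <;> fin_cases j <;> simp [wedge] <;> ring

/-- The raised density `ρ² sin θ F^{μν}`. -/
def W8 (M a A B α β u₀ : ℝ) (x : Fin 4 → ℝ) : Matrix (Fin 4) (Fin 4) ℝ :=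
  !![0, 0, (x 1 ^ 2 + a ^ 2) / Del M a x * (G8 A B α β u₀ (x 2) * f1_12 a A B α β (x 0) (x 3)),
        rho2 a x / Del M a x * (K8 A B α β u₀ (x 2) * f2_12 a A B α β (x 0) (x 3));
      0, 0, 0, 0;
      -((x 1 ^ 2 + a ^ 2) / Del M a x * (G8 A B α β u₀ (x 2) * f1_12 a A B α β (x 0) (x 3))), 0, 0,
        -(a / Del M a x * (G8 A B α β u₀ (x 2) * f1_12 a A B α β (x 0) (x 3)));
      -(rho2 a x / Del M a x * (K8 A B α β u₀ (x 2) * f2_12 a A B α β (x 0) (x 3))), 0,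
        a / Del M a x * (G8 A B α β u₀ (x 2) * f1_12 a A B α β (x 0) (x 3)), 0]

lemma raise_eq {M a A B α β u₀ : ℝ} (ha : 0 < a) (haM : a < M) {x : Fin 4 → ℝ}
    (hx : x ∈ KerrExt M a) (μ ν : Fin 4) :
    rho2 a x * Real.sin (x 2) *
      ∑ i : Fin 4, ∑ j : Fin 4, (kerr M a x)⁻¹ μ i * (kerr M a x)⁻¹ ν j * F8 a A B α β u₀ x i j
      = W8 M a A B α β u₀ x μ ν := by
  have hD := (Del_pos ha haM hx).ne'
  have hR := (rho2_pos ha haM hx).ne'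
  have hs : Real.sin (x 2) ≠ 0 := (Real.sin_pos_of_pos_of_lt_pi hx.2.1 hx.2.2).ne'
  have hc := Real.cos_sq' (x 2)
  rw [kerr_inv ha haM hx, F8_eq, W8]
  fin_cases μ <;> fin_cases ν <;>
    simp [Fin.sum_univ_four, G8, hR, hs] <;> (try field_simp) <;>
    (try simp only [Sig2, rho2, Del, hc]) <;> ring

lemma pd_zero (μ : Fin 4) (x : Fin 4 → ℝ) : pd μ (fun _ => (0 : ℝ)) x = 0 := by
  simp [pd]

lemma pd_neg (μ : Fin 4) (f : (Fin 4 → ℝ) → ℝ) (x : Fin 4 → ℝ) :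
    pd μ (fun y => -f y) x = -pd μ f x := by
  simp [pd, fderiv_fun_neg]

section derivs
variable {M a A B α β u₀ : ℝ} {x : Fin 4 → ℝ}

lemma Del_diff (M a : ℝ) (x : Fin 4 → ℝ) : DifferentiableAt ℝ (Del M a) x := by
  unfold Del; fun_prop

lemma rho2_diff (a : ℝ) (x : Fin 4 → ℝ) : DifferentiableAt ℝ (rho2 a) x := by
  unfold rho2; fun_prop

lemma pd_W02 (hA : A ≠ 0) (hab : 0 < α ^ 2 + β ^ 2) (h0 : 0 < x 2) (h1 : x 2 < Real.pi)
    (hD : Del M a x ≠ 0) :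
    pd 2 (fun y => (y 1 ^ 2 + a ^ 2) / Del M a y *
      (G8 A B α β u₀ (y 2) * f1_12 a A B α β (y 0) (y 3))) x =
    (x 1 ^ 2 + a ^ 2) / Del M a x *
      (K8 A B α β u₀ (x 2) * (-B * Real.sin (x 2) ^ 2 - A) * f1_12 a A B α β (x 0) (x 3)) := by
  have d1 := Del_diff M a x
  have d2 := f1_diff (a := a) (B := B) (α := α) (β := β) hA x
  have d3 := G8_diff (A := A) (B := B) (u₀ := u₀) hab h0 h1
  apply pd_of_update
  · have d4 := d1.fun_inv hD
    simp only [div_eq_mul_inv]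
    exact DifferentiableAt.fun_mul (DifferentiableAt.fun_mul (by fun_prop) d4) (d3.fun_mul d2)
  · simpa [Del] using (((G8_deriv (A := A) (B := B) (u₀ := u₀) hab h0 h1).mul_const
      (f1_12 a A B α β (x 0) (x 3))).const_mul ((x 1 ^ 2 + a ^ 2) / Del M a x))

lemma pd_W20 (hA : A ≠ 0) (hab : 0 < α ^ 2 + β ^ 2) (h0 : 0 < x 2) (h1 : x 2 < Real.pi)
    (hD : Del M a x ≠ 0) :
    pd 0 (fun y => (y 1 ^ 2 + a ^ 2) / Del M a y *
      (G8 A B α β u₀ (y 2) * f1_12 a A B α β (y 0) (y 3))) x =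
    (x 1 ^ 2 + a ^ 2) / Del M a x *
      (G8 A B α β u₀ (x 2) * (-(B / a) * f2_12 a A B α β (x 0) (x 3))) := by
  have d1 := Del_diff M a x
  have d2 := f1_diff (a := a) (B := B) (α := α) (β := β) hA x
  have d3 := G8_diff (A := A) (B := B) (u₀ := u₀) hab h0 h1
  apply pd_of_update
  · have d4 := d1.fun_inv hD
    simp only [div_eq_mul_inv]
    exact DifferentiableAt.fun_mul (DifferentiableAt.fun_mul (by fun_prop) d4) (d3.fun_mul d2)
  · simpa [Del] using (((f1_dt (a := a) (B := B) (α := α) (β := β) hA (x 0) (x 3)).const_mul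
      (G8 A B α β u₀ (x 2))).const_mul ((x 1 ^ 2 + a ^ 2) / Del M a x))

lemma pd_W23 (hA : A ≠ 0) (hab : 0 < α ^ 2 + β ^ 2) (h0 : 0 < x 2) (h1 : x 2 < Real.pi)
    (hD : Del M a x ≠ 0) :
    pd 3 (fun y => a / Del M a y *
      (G8 A B α β u₀ (y 2) * f1_12 a A B α β (y 0) (y 3))) x =
    a / Del M a x *
      (G8 A B α β u₀ (x 2) * (-A * f2_12 a A B α β (x 0) (x 3))) := by
  have d1 := Del_diff M a x
  have d2 := f1_diff (a := a) (B := B) (α := α) (β := β) hA x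
  have d3 := G8_diff (A := A) (B := B) (u₀ := u₀) hab h0 h1
  apply pd_of_update
  · have d4 := d1.fun_inv hD
    simp only [div_eq_mul_inv]
    exact DifferentiableAt.fun_mul (DifferentiableAt.fun_mul (by fun_prop) d4) (d3.fun_mul d2)
  · simpa [Del] using (((f1_dp (a := a) (B := B) (α := α) (β := β) hA (x 0) (x 3)).const_mul
      (G8 A B α β u₀ (x 2))).const_mul (a / Del M a x))

lemma pd_W32 (hA : A ≠ 0) (hab : 0 < α ^ 2 + β ^ 2) (h0 : 0 < x 2) (h1 : x 2 < Real.pi)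
    (hD : Del M a x ≠ 0) :
    pd 2 (fun y => a / Del M a y *
      (G8 A B α β u₀ (y 2) * f1_12 a A B α β (y 0) (y 3))) x =
    a / Del M a x *
      (K8 A B α β u₀ (x 2) * (-B * Real.sin (x 2) ^ 2 - A) * f1_12 a A B α β (x 0) (x 3)) := by
  have d1 := Del_diff M a x
  have d2 := f1_diff (a := a) (B := B) (α := α) (β := β) hA x
  have d3 := G8_diff (A := A) (B := B) (u₀ := u₀) hab h0 h1
  apply pd_of_update
  · have d4 := d1.fun_inv hD
    simp only [div_eq_mul_inv]
    exact DifferentiableAt.fun_mul (DifferentiableAt.fun_mul (by fun_prop) d4) (d3.fun_mul d2)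
  · simpa [Del] using (((G8_deriv (A := A) (B := B) (u₀ := u₀) hab h0 h1).mul_const
      (f1_12 a A B α β (x 0) (x 3))).const_mul (a / Del M a x))

lemma pd_W03 (hA : A ≠ 0) (hab : 0 < α ^ 2 + β ^ 2) (h0 : 0 < x 2) (h1 : x 2 < Real.pi)
    (hD : Del M a x ≠ 0) :
    pd 3 (fun y => rho2 a y / Del M a y *
      (K8 A B α β u₀ (y 2) * f2_12 a A B α β (y 0) (y 3))) x =
    rho2 a x / Del M a x *
      (K8 A B α β u₀ (x 2) * (A * f1_12 a A B α β (x 0) (x 3))) := by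
  have d1 := Del_diff M a x
  have d2 := f2_diff (a := a) (B := B) (α := α) (β := β) hA x
  have d3 := K8_diff (A := A) (B := B) (u₀ := u₀) hab h0 h1
  apply pd_of_update
  · have d4 := d1.fun_inv hD
    simp only [div_eq_mul_inv]
    exact ((rho2_diff a x).fun_mul d4).fun_mul (d3.fun_mul d2)
  · simpa [Del, rho2] using (((f2_dp (a := a) (B := B) (α := α) (β := β) hA (x 0) (x 3)).const_mul
      (K8 A B α β u₀ (x 2))).const_mul (rho2 a x / Del M a x))

lemma pd_W30 (hA : A ≠ 0) (hab : 0 < α ^ 2 + β ^ 2) (h0 : 0 < x 2) (h1 : x 2 < Real.pi)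
    (hD : Del M a x ≠ 0) :
    pd 0 (fun y => rho2 a y / Del M a y *
      (K8 A B α β u₀ (y 2) * f2_12 a A B α β (y 0) (y 3))) x =
    rho2 a x / Del M a x *
      (K8 A B α β u₀ (x 2) * (B / a * f1_12 a A B α β (x 0) (x 3))) := by
  have d1 := Del_diff M a x
  have d2 := f2_diff (a := a) (B := B) (α := α) (β := β) hA x
  have d3 := K8_diff (A := A) (B := B) (u₀ := u₀) hab h0 h1
  apply pd_of_update
  · have d4 := d1.fun_inv hD
    simp only [div_eq_mul_inv]
    exact ((rho2_diff a x).fun_mul d4).fun_mul (d3.fun_mul d2)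
  · simpa [Del, rho2] using (((f2_dt (a := a) (B := B) (α := α) (β := β) hA (x 0) (x 3)).const_mul
      (K8 A B α β u₀ (x 2))).const_mul (rho2 a x / Del M a x))

/-! Derivatives of the components of `F8` itself. -/

lemma pd_F02 (hA : A ≠ 0) (hab : 0 < α ^ 2 + β ^ 2) (h0 : 0 < x 2) (h1 : x 2 < Real.pi) :
    pd 1 (fun y => K8 A B α β u₀ (y 2) * f1_12 a A B α β (y 0) (y 3)) x = 0 ∧
    pd 3 (fun y => K8 A B α β u₀ (y 2) * f1_12 a A B α β (y 0) (y 3)) x =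
      K8 A B α β u₀ (x 2) * (-A * f2_12 a A B α β (x 0) (x 3)) := by
  have d2 := f1_diff (a := a) (B := B) (α := α) (β := β) hA x
  have d3 := K8_diff (A := A) (B := B) (u₀ := u₀) hab h0 h1
  constructor <;> apply pd_of_update (d3.fun_mul d2)
  · simpa using hasDerivAt_const (x 1) (K8 A B α β u₀ (x 2) * f1_12 a A B α β (x 0) (x 3))
  · simpa using ((f1_dp (a := a) (B := B) (α := α) (β := β) hA (x 0) (x 3)).const_mul
      (K8 A B α β u₀ (x 2)))

lemma pd_F03 (hA : A ≠ 0) (hab : 0 < α ^ 2 + β ^ 2) (h0 : 0 < x 2) (h1 : x 2 < Real.pi) :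
    pd 1 (fun y => G8 A B α β u₀ (y 2) * f2_12 a A B α β (y 0) (y 3)) x = 0 ∧
    pd 2 (fun y => G8 A B α β u₀ (y 2) * f2_12 a A B α β (y 0) (y 3)) x =
      K8 A B α β u₀ (x 2) * (-B * Real.sin (x 2) ^ 2 - A) * f2_12 a A B α β (x 0) (x 3) := by
  have d2 := f2_diff (a := a) (B := B) (α := α) (β := β) hA x
  have d3 := G8_diff (A := A) (B := B) (u₀ := u₀) hab h0 h1
  constructor <;> apply pd_of_update (d3.fun_mul d2)
  · simpa using hasDerivAt_const (x 1) (G8 A B α β u₀ (x 2) * f2_12 a A B α β (x 0) (x 3))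
  · simpa using ((G8_deriv (A := A) (B := B) (u₀ := u₀) hab h0 h1).mul_const
      (f2_12 a A B α β (x 0) (x 3)))

lemma pd_F23 (hA : A ≠ 0) (hab : 0 < α ^ 2 + β ^ 2) (h0 : 0 < x 2) (h1 : x 2 < Real.pi) :
    pd 1 (fun y => a * Real.sin (y 2) *
      (G8 A B α β u₀ (y 2) * f1_12 a A B α β (y 0) (y 3))) x = 0 ∧
    pd 0 (fun y => a * Real.sin (y 2) *
      (G8 A B α β u₀ (y 2) * f1_12 a A B α β (y 0) (y 3))) x =
      a * Real.sin (x 2) *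
        (G8 A B α β u₀ (x 2) * (-(B / a) * f2_12 a A B α β (x 0) (x 3))) := by
  have d2 := f1_diff (a := a) (B := B) (α := α) (β := β) hA x
  have d3 := G8_diff (A := A) (B := B) (u₀ := u₀) hab h0 h1
  have d4 : DifferentiableAt ℝ (fun y : Fin 4 → ℝ => a * Real.sin (y 2)) x := by fun_prop
  constructor <;> apply pd_of_update (d4.fun_mul (d3.fun_mul d2))
  · simpa using hasDerivAt_const (x 1) (a * Real.sin (x 2) *
      (G8 A B α β u₀ (x 2) * f1_12 a A B α β (x 0) (x 3)))
  · simpa using (((f1_dt (a := a) (B := B) (α := α) (β := β) hA (x 0) (x 3)).const_mul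
      (G8 A B α β u₀ (x 2))).const_mul (a * Real.sin (x 2)))

lemma F8_closed (ha : 0 < a) (hA : A ≠ 0) (hab : 0 < α ^ 2 + β ^ 2) :
    Closed2Form (F8 a A B α β u₀) (KerrExt M a) := by
  intro x hx μ ν lam
  obtain ⟨e1, e2⟩ := pd_F02 (a := a) (B := B) (u₀ := u₀) hA hab hx.2.1 hx.2.2
  obtain ⟨e3, e4⟩ := pd_F03 (a := a) (B := B) (u₀ := u₀) hA hab hx.2.1 hx.2.2
  obtain ⟨e5, e6⟩ := pd_F23 (a := a) (B := B) (u₀ := u₀) hA hab hx.2.1 hx.2.2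
  have ha' := ha.ne'
  simp only [F8_eq]
  fin_cases μ <;> fin_cases ν <;> fin_cases lam <;>
    simp [pd_zero, pd_neg, e1, e2, e3, e4, e5, e6] <;>
    (try simp only [G8]) <;> (try field_simp) <;> (try ring)

lemma current_eq (ha : 0 < a) (haM : a < M) (hA : A ≠ 0) (hab : 0 < α ^ 2 + β ^ 2)
    (hx : x ∈ KerrExt M a) (μ : Fin 4) :
    current M a (F8 a A B α β u₀) x μ = (rho2 a x * Real.sin (x 2))⁻¹ *
      ((B * (x 1 ^ 2 + a ^ 2) + a ^ 2 * A) * K8 A B α β u₀ (x 2) / (a * Del M a x)) *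
      ![-(a * Real.sin (x 2) ^ 2 * f1_12 a A B α β (x 0) (x 3)), 0,
        Real.sin (x 2) * f2_12 a A B α β (x 0) (x 3),
        -f1_12 a A B α β (x 0) (x 3)] μ := by
  have hD := (Del_pos ha haM hx).ne'
  have ha' := ha.ne'
  have hc := Real.cos_sq' (x 2)
  have key : ∀ ν : Fin 4, pd ν (fun y => rho2 a y * Real.sin (y 2) *
      ∑ i : Fin 4, ∑ j : Fin 4, (kerr M a y)⁻¹ μ i * (kerr M a y)⁻¹ ν j *
        F8 a A B α β u₀ y i j) x = pd ν (fun y => W8 M a A B α β u₀ y μ ν) x := by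
    intro ν
    unfold pd
    rw [Filter.EventuallyEq.fderiv_eq]
    filter_upwards [(isOpen_ext M a).mem_nhds hx] with y hy
    exact raise_eq ha haM hy μ ν
  unfold current
  simp only [key]
  rw [mul_assoc]
  congr 1
  have e1 := pd_W02 (B := B) (u₀ := u₀) hA hab hx.2.1 hx.2.2 hD
  have e2 := pd_W03 (B := B) (u₀ := u₀) hA hab hx.2.1 hx.2.2 hD
  have e3 := pd_W20 (B := B) (u₀ := u₀) hA hab hx.2.1 hx.2.2 hD
  have e4 := pd_W30 (B := B) (u₀ := u₀) hA hab hx.2.1 hx.2.2 hD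
  have e5 := pd_W23 (B := B) (u₀ := u₀) hA hab hx.2.1 hx.2.2 hD
  have e6 := pd_W32 (B := B) (u₀ := u₀) hA hab hx.2.1 hx.2.2 hD
  simp only [W8]
  fin_cases μ <;> simp [Fin.sum_univ_four, pd_zero, pd_neg, e1, e2, e3, e4, e5, e6] <;>
    (try simp only [G8]) <;> (try field_simp) <;>
    (try simp only [rho2, hc]) <;> (try ring)

lemma F8_ff (ha : 0 < a) (haM : a < M) (hA : A ≠ 0) (hab : 0 < α ^ 2 + β ^ 2) :
    ForceFree M a (F8 a A B α β u₀) (KerrExt M a) := by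
  intro x hx μ
  simp only [current_eq ha haM hA hab hx, F8_eq]
  generalize (rho2 a x * Real.sin (x 2))⁻¹ *
      ((B * (x 1 ^ 2 + a ^ 2) + a ^ 2 * A) * K8 A B α β u₀ (x 2) / (a * Del M a x)) = Q
  fin_cases μ <;> simp [Fin.sum_univ_four, G8] <;> ring

lemma F8_sq (ha : 0 < a) (haM : a < M) (hA : A ≠ 0) (hab : 0 < α ^ 2 + β ^ 2)
    (hx : x ∈ KerrExt M a) :
    Fsq M a (F8 a A B α β u₀) x = -2 * (u12 M a u₀ A B x) ^ 2 := by
  have hD := Del_pos ha haM hx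
  have hR := rho2_pos ha haM hx
  have hs : 0 < Real.sin (x 2) := Real.sin_pos_of_pos_of_lt_pi hx.2.1 hx.2.2
  have hT : 0 < Real.tan (x 2 / 2) ^ A := Real.rpow_pos_of_pos (tan_half_pos hx.2.1 hx.2.2) A
  have hc := Real.cos_sq' (x 2)
  have hQ : rho2 a x * Real.sin (x 2) ≠ 0 := by positivity
  have e : Fsq M a (F8 a A B α β u₀) x = (rho2 a x * Real.sin (x 2))⁻¹ *
      ∑ μ : Fin 4, ∑ ν : Fin 4, W8 M a A B α β u₀ x μ ν * F8 a A B α β u₀ x μ ν := by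
    simp only [← raise_eq ha haM hx, Fsq, Finset.mul_sum, Finset.sum_mul]
    refine Finset.sum_congr rfl fun μ _ => Finset.sum_congr rfl fun ν _ =>
      Finset.sum_congr rfl fun i _ => Finset.sum_congr rfl fun j _ => ?_
    field_simp
  have e2 : Fsq M a (F8 a A B α β u₀) x = -2 * K8 A B α β u₀ (x 2) ^ 2 / Del M a x *
      (f1_12 a A B α β (x 0) (x 3) ^ 2 + f2_12 a A B α β (x 0) (x 3) ^ 2) := by
    rw [e, F8_eq, W8]
    simp [Fin.sum_univ_four, G8]
    field_simp
    simp only [rho2, hc]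
    ring
  rw [e2, f_sq hA, K8, u12]
  simp only [div_pow, mul_pow]
  rw [Real.sq_sqrt hD.le, Real.sq_sqrt hab.le]
  field_simp

end derivs

/-- F₈ is closed and force-free on U, and F₈² = −2u², so F₈ is
electrically dominated. -/
theorem kerr_F8_forcefree (M a A B α β u₀ : ℝ) (ha : 0 < a) (haM : a < M)
    (hA : A ≠ 0) (hab : 0 < α ^ 2 + β ^ 2) :
    Closed2Form (F8 a A B α β u₀) (KerrExt M a) ∧
    ForceFree M a (F8 a A B α β u₀) (KerrExt M a) ∧
    ∀ x ∈ KerrExt M a,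
      Fsq M a (F8 a A B α β u₀) x = -2 * (u12 M a u₀ A B x) ^ 2 := by
  exact ⟨F8_closed ha hA hab, F8_ff ha haM hA hab, fun x hx => F8_sq ha haM hA hab hx⟩
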